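/- Let N ≥ 1 and γ, δ ∈ ℝ. With ℛ_{M+1}(γ,δ) denoting, for each M ≥ 0, the (M+1)×(M+1) tridiagonal matrix with diagonal entries M(γ+2n+1) − n(γ−δ+2n), superdiagonal entries (M−n)(γ+n+1), and subdiagonal entries n(M+δ+1−n) (0-indexed), one has for every real μ: det(μ·I_{N+1} + ℛ_{N+1}(γ,δ)) = μ · det((μ + γ + δ + 2)·I_N + ℛ_N(γ+1, δ+1)), where ℛ_N(γ+1,δ+1) is the N×N matrix built with parameters (γ+1, δ+1) and M = N−1. In particular, with λ(t) = −t(t+γ+δ+1), R_{N+1}(λ(x); γ, δ, N) = λ(x)·R_N(λ(x)+(γ+δ+2); γ+1, δ+1, N−1). -/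

import Mathlib

/-- The dual Hahn matrix `ℛ_{N+1}(γ, δ)`: diagonal entries `N(γ + 2n + 1) - n(γ - δ + 2n)`,
superdiagonal entries `(N - n)(γ + n + 1)`, subdiagonal entries `n(N + δ + 1 - n)`
(0-indexed, size `N + 1`). -/
def dualHahnR (N : ℕ) (γ δ : ℝ) : Matrix (Fin (N + 1)) (Fin (N + 1)) ℝ :=
  Matrix.of fun i j =>
    if (j : ℕ) = (i : ℕ) + 1 then ((N : ℝ) - (i : ℕ)) * (γ + (i : ℕ) + 1)
    else if (i : ℕ) = (j : ℕ) + 1 then ((i : ℕ) : ℝ) * ((N : ℝ) + δ + 1 - (i : ℕ))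
    else if i = j then (N : ℝ) * (γ + 2 * (i : ℕ) + 1) - ((i : ℕ) : ℝ) * (γ - δ + 2 * (i : ℕ))
    else 0

/-- Writing `B n` and `D n` for the super- and subdiagonal entries, the diagonal entries of
`ℛ_{N+1}` are `B n + D n`; this is the left, bidiagonal factor of `ℛ_{N+1}`. -/
def dualHahnLeft (N : ℕ) (γ δ : ℝ) : Matrix (Fin (N + 1)) (Fin N) ℝ :=
  Matrix.of fun i k =>
    (if (k : ℕ) = i then ((N : ℝ) - (i : ℕ)) * (γ + (i : ℕ) + 1) else 0) +
      if (k : ℕ) + 1 = i then ((i : ℕ) : ℝ) * ((N : ℝ) + δ + 1 - (i : ℕ)) else 0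

/-- The right, bidiagonal factor of `ℛ_{N+1}`. -/
def dualHahnRight (N : ℕ) : Matrix (Fin N) (Fin (N + 1)) ℝ :=
  Matrix.of fun k j => (if k.castSucc = j then 1 else 0) + if k.succ = j then 1 else 0

theorem dualHahnLeft_mul_right (N : ℕ) (γ δ : ℝ) :
    dualHahnLeft N γ δ * dualHahnRight N = dualHahnR N γ δ := by
  ext i j
  rw [Matrix.mul_apply]
  have hsum : ∑ k, dualHahnLeft N γ δ i k * dualHahnRight N k j = ∑ k ∈ Finset.range N,
      ((if k = (i : ℕ) then ((N : ℝ) - (i : ℕ)) * (γ + (i : ℕ) + 1) *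
          ((if (i : ℕ) = j then 1 else 0) + if (i : ℕ) + 1 = j then 1 else 0) else 0) +
        if k + 1 = (i : ℕ) then ((i : ℕ) : ℝ) * ((N : ℝ) + δ + 1 - (i : ℕ)) *
          ((if (i : ℕ) = j + 1 then 1 else 0) + if (i : ℕ) = j then 1 else 0) else 0) := by
    rw [← Fin.sum_univ_eq_sum_range]
    refine Finset.sum_congr rfl fun k _ => ?_
    simp only [dualHahnLeft, dualHahnRight, Matrix.of_apply, Fin.ext_iff, Fin.val_castSucc,
      Fin.val_succ]
    split_ifs <;> first | omega | ring1
  rw [hsum, Finset.sum_add_distrib, Finset.sum_ite_eq']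
  obtain ⟨i, hi⟩ := i
  obtain ⟨j, hj⟩ := j
  have hN : N ≤ i → (N : ℝ) = i := fun h => by exact_mod_cast (by omega : N = i)
  cases i with
  | zero =>
    simp only [dualHahnR, Matrix.of_apply, Fin.ext_iff, Finset.mem_range]
    split_ifs with h <;> first | contradiction | omega | simp [hN (by omega)] | simp
  | succ m =>
    simp only [dualHahnR, Matrix.of_apply, Fin.ext_iff, Finset.mem_range, Nat.add_right_cancel_iff,
      Finset.sum_ite_eq']
    split_ifs with h <;>
      first | omega | (push_cast; ring1) | (rw [hN (by omega)]; push_cast; ring1)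

theorem dualHahnRight_mul_left (N : ℕ) (γ δ : ℝ) :
    dualHahnRight (N + 1) * dualHahnLeft (N + 1) γ δ =
      (γ + δ + 2) • (1 : Matrix (Fin (N + 1)) (Fin (N + 1)) ℝ) +
        dualHahnR N (γ + 1) (δ + 1) := by
  ext k l
  simp only [Matrix.mul_apply, dualHahnRight, Matrix.of_apply, add_mul, ite_mul, one_mul, zero_mul,
    Finset.sum_add_distrib, Finset.sum_ite_eq, Finset.mem_univ, if_true]
  simp only [dualHahnLeft, dualHahnR, Matrix.of_apply,
    Matrix.add_apply, Matrix.smul_apply, Matrix.one_apply, Fin.ext_iff, Fin.val_castSucc,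
    Fin.val_succ, Nat.add_right_cancel_iff, smul_eq_mul]
  obtain ⟨k, hk⟩ := k
  obtain ⟨l, hl⟩ := l
  dsimp only
  split_ifs <;> first | omega | (subst_vars; push_cast; ring1)

/-- A form of the Weinstein–Aronszajn identity valid for every `μ`, including `μ = 0`. -/
theorem det_smul_one_add_mul_comm {R : Type*} [CommRing R] (N : ℕ) (μ : R)
    (A : Matrix (Fin (N + 1)) (Fin N) R) (B : Matrix (Fin N) (Fin (N + 1)) R) :
    (μ • (1 : Matrix (Fin (N + 1)) (Fin (N + 1)) R) + A * B).det =
      μ * (μ • (1 : Matrix (Fin N) (Fin N) R) + B * A).det := by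
  have h := congrArg (Polynomial.eval μ) (Matrix.charpoly_mul_comm_of_le (-A) B (by simp))
  simpa [Matrix.eval_charpoly, ← Matrix.smul_one_eq_diagonal] using h

theorem dualHahn_det_rec (N : ℕ) (hN : 1 ≤ N) (γ δ : ℝ) (μ : ℝ) :
    (μ • (1 : Matrix (Fin (N + 1)) (Fin (N + 1)) ℝ) + dualHahnR N γ δ).det =
      μ * ((μ + γ + δ + 2) • (1 : Matrix (Fin (N - 1 + 1)) (Fin (N - 1 + 1)) ℝ) +
        dualHahnR (N - 1) (γ + 1) (δ + 1)).det := by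
  obtain ⟨M, rfl⟩ := Nat.exists_eq_add_of_le' hN
  rw [← dualHahnLeft_mul_right, det_smul_one_add_mul_comm, dualHahnRight_mul_left, ← add_assoc,
    ← add_smul, add_tsub_cancel_right, add_assoc, add_assoc, add_assoc]
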